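/- For every p ∈ (1,∞), the Fourier binest algebra A_FB^p contains no nonzero finite-rank operator: if T ∈ A_FB^p and T has finite rank, then T = 0. -/

import Mathlib

open MeasureTheory Complex Filter Topology
open scoped ENNReal NNReal

noncomputable section

/-- `L^p(ℝ)` with complex values. -/
abbrev LpR (p : ℝ≥0∞) := MeasureTheory.Lp ℂ p (volume : Measure ℝ)

/-- The Bochner space `L^p(ℝ; L^q(ℝ))`. -/
abbrev LpLq (p q : ℝ≥0∞) [Fact (1 ≤ q)] := MeasureTheory.Lp (LpR q) p (volume : Measure ℝ)

/-- `T` is the operator of multiplication by `φ`. -/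
def IsMulOp (p : ℝ≥0∞) [Fact (1 ≤ p)] (φ : ℝ → ℂ) (T : LpR p →L[ℂ] LpR p) : Prop :=
  ∀ f : LpR p, (T f : ℝ → ℂ) =ᵐ[volume] fun x => φ x * (f : ℝ → ℂ) x

/-- `T` is the operator of translation by `μ`: `(T f)(x) = f (x - μ)`. -/
def IsTransOp (p : ℝ≥0∞) [Fact (1 ≤ p)] (μ : ℝ) (T : LpR p →L[ℂ] LpR p) : Prop :=
  ∀ f : LpR p, (T f : ℝ → ℂ) =ᵐ[volume] fun x => (f : ℝ → ℂ) (x - μ)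

/-- A set of operators is closed in the strong operator topology (the topology of
pointwise norm convergence) if it contains every operator which is an SOT-limit point. -/
def IsSOTClosed (p : ℝ≥0∞) [Fact (1 ≤ p)] (S : Set (LpR p →L[ℂ] LpR p)) : Prop :=
  ∀ T : LpR p →L[ℂ] LpR p,
    (⇑T ∈ closure ((fun A : LpR p →L[ℂ] LpR p => (A : LpR p → LpR p)) '' S)) → T ∈ S

/-- The generators of the parabolic algebra: multiplications `M_λ`, `λ ≥ 0`, and
translations `D_μ`, `μ ≥ 0`. -/
def parabolicGens (p : ℝ≥0∞) [Fact (1 ≤ p)] : Set (LpR p →L[ℂ] LpR p) :=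
  {T | ∃ l : ℝ, 0 ≤ l ∧ IsMulOp p (fun x => Complex.exp (Complex.I * l * x)) T} ∪
  {T | ∃ m : ℝ, 0 ≤ m ∧ IsTransOp p m T}

/-- The parabolic algebra: the smallest SOT-closed subalgebra of `B(L^p(ℝ))` containing
the multiplication semigroup and the translation semigroup. -/
def parabolicAlgebra (p : ℝ≥0∞) [Fact (1 ≤ p)] : Set (LpR p →L[ℂ] LpR p) :=
  ⋂₀ {S | parabolicGens p ⊆ S ∧ IsSOTClosed p S ∧
      ∃ A : Subalgebra ℂ (LpR p →L[ℂ] LpR p), (A : Set (LpR p →L[ℂ] LpR p)) = S}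

/-- The Hardy space `H^p(ℝ)`, as a subset of `L^p(ℝ)`. -/
def hardy (p : ℝ≥0∞) [Fact (1 ≤ p)] : Set (LpR p) :=
  {f | ∀ u : ℂ, 0 < u.im → ∫ x : ℝ, (f : ℝ → ℂ) x / ((x : ℂ) + u) = 0}

/-- `L^p[t,∞)`, the subspace of functions vanishing a.e. on `(-∞, t)`. -/
def LpHalfLine (p : ℝ≥0∞) [Fact (1 ≤ p)] (t : ℝ) : Set (LpR p) :=
  {f | ∀ᵐ x : ℝ, x < t → (f : ℝ → ℂ) x = 0}

/-- The image of the Hardy space under multiplication by the function `φ`. -/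
def mulHardy (p : ℝ≥0∞) [Fact (1 ≤ p)] (φ : ℝ → ℂ) : Set (LpR p) :=
  {g | ∃ f ∈ hardy p, (g : ℝ → ℂ) =ᵐ[volume] fun x => φ x * (f : ℝ → ℂ) x}

/-- The Fourier binest algebra: operators leaving invariant each `L^p[t,∞)` and each
`e^{iλx}H^p(ℝ)`. -/
def fourierBinest (p : ℝ≥0∞) [Fact (1 ≤ p)] : Set (LpR p →L[ℂ] LpR p) :=
  {T | (∀ t : ℝ, ∀ f ∈ LpHalfLine p t, T f ∈ LpHalfLine p t) ∧
       (∀ l : ℝ, ∀ f ∈ mulHardy p (fun x => Complex.exp (Complex.I * l * x)),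
          T f ∈ mulHardy p (fun x => Complex.exp (Complex.I * l * x)))}

/-- `T` is the `(p,q)`-integral operator with kernel `k`. -/
def IsIntOp (p q : ℝ≥0∞) [Fact (1 ≤ p)] [Fact (1 ≤ q)] (k : LpLq p q)
    (T : LpR p →L[ℂ] LpR p) : Prop :=
  ∀ f : LpR p, (T f : ℝ → ℂ) =ᵐ[volume]
    fun x => ∫ y : ℝ, ((k : ℝ → LpR q) x : ℝ → ℂ) y * (f : ℝ → ℂ) y

/-- `G^p`, the set of `(p,q)`-integral operators on `L^p(ℝ)`. -/
def Gp (p q : ℝ≥0∞) [Fact (1 ≤ p)] [Fact (1 ≤ q)] : Set (LpR p →L[ℂ] LpR p) :=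
  {T | ∃ k : LpLq p q, IsIntOp p q k T}

lemma memLp_of_norm_mul_one_add_abs_le {q : ℝ≥0∞} (hq : 1 < q) (hq' : q ≠ ⊤) {g : ℝ → ℂ}
    (hg : AEStronglyMeasurable g volume) {C : ℝ} (hC : ∀ᵐ x : ℝ, ‖g x‖ * (1 + |x|) ≤ C) :
    MemLp g q volume := by
  have hq0 : 0 < q := zero_lt_one.trans hq
  have h1 : 1 < q.toReal := by
    simpa using (ENNReal.toReal_lt_toReal ENNReal.one_ne_top hq').2 hq
  have hw : MemLp (fun x : ℝ => ((1 + |x|)⁻¹ : ℝ)) q volume := by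
    rw [← integrable_norm_rpow_iff (by fun_prop) hq0.ne' hq']
    refine (integrable_one_add_norm (E := ℝ) (μ := volume) (r := q.toReal) (by simpa)).congr
      (Eventually.of_forall fun x => ?_)
    have hx : 0 < 1 + |x| := by positivity
    simp only [Real.norm_eq_abs, abs_inv, abs_of_pos hx]
    rw [Real.inv_rpow hx.le, Real.rpow_neg hx.le]
  refine hw.of_le_mul (c := C) hg ?_
  filter_upwards [hC] with x hx
  have hx' : 0 < 1 + |x| := by positivity
  rw [Real.norm_eq_abs, abs_inv, abs_of_pos hx', ← div_eq_mul_inv, le_div_iff₀ hx']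
  exact hx

lemma one_add_abs_le_mul_norm_add {x d : ℝ} {u : ℂ} (hd : 0 < d) (h : d ≤ ‖(x : ℂ) + u‖) :
    1 + |x| ≤ (1 + (1 + ‖u‖) / d) * ‖(x : ℂ) + u‖ := by
  have h1 : |x| ≤ ‖(x : ℂ) + u‖ + ‖u‖ := by
    simpa using norm_sub_le ((x : ℂ) + u) u
  have h2 : 1 + ‖u‖ ≤ (1 + ‖u‖) / d * ‖(x : ℂ) + u‖ := by
    rw [div_mul_eq_mul_div, le_div_iff₀ hd]
    gcongr
  linarith

lemma im_le_norm_ofReal_add (x : ℝ) (u : ℂ) : u.im ≤ ‖(x : ℂ) + u‖ := by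
  simpa using (le_abs_self _).trans (Complex.abs_im_le_norm ((x : ℂ) + u))

lemma ofReal_add_ne_zero (x : ℝ) {u : ℂ} (hu : 0 < u.im) : (x : ℂ) + u ≠ 0 :=
  norm_pos_iff.1 (hu.trans_le (im_le_norm_ofReal_add x u))

lemma memLp_inv_ofReal_add {q : ℝ≥0∞} (hq : 1 < q) (hq' : q ≠ ⊤) {u : ℂ} (hu : 0 < u.im) :
    MemLp (fun x : ℝ => ((x : ℂ) + u)⁻¹) q volume := by
  refine memLp_of_norm_mul_one_add_abs_le hq hq' (Measurable.aestronglyMeasurable (by fun_prop))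
    (C := 1 + (1 + ‖u‖) / u.im) (Eventually.of_forall fun x => ?_)
  rw [norm_inv, inv_mul_le_iff₀ (norm_pos_iff.2 (ofReal_add_ne_zero x hu)), mul_comm]
  exact one_add_abs_le_mul_norm_add hu (im_le_norm_ofReal_add x u)

lemma integrable_div_ofReal_add {p : ℝ≥0∞} (hp : 1 < p) (hp' : p ≠ ⊤) {f : ℝ → ℂ}
    (hf : MemLp f p volume) {u : ℂ} (hu : 0 < u.im) :
    Integrable (fun x : ℝ => f x / ((x : ℂ) + u)) volume := by
  have hc : p.HolderConjugate p.conjExponent := .conjExponent hp.le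
  have h1 : 1 < p.conjExponent := (ENNReal.HolderConjugate.lt_top_iff_one_lt p _).1 hp'.lt_top
  have h2 : p.conjExponent ≠ ⊤ :=
    ((ENNReal.HolderConjugate.lt_top_iff_one_lt p.conjExponent p).2 hp).ne
  simpa only [div_eq_mul_inv] using! hf.integrable_mul (memLp_inv_ofReal_add h1 h2 hu)

/-- The defining condition of the Hardy space, for functions. -/
def IsHardyFun (f : ℝ → ℂ) : Prop :=
  ∀ u : ℂ, 0 < u.im → ∫ x : ℝ, f x / ((x : ℂ) + u) = 0

lemma IsHardyFun.congr_ae {f g : ℝ → ℂ} (hf : IsHardyFun f) (h : f =ᵐ[volume] g) :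
    IsHardyFun g := fun u hu => by
  rw [← hf u hu]
  refine integral_congr_ae ?_
  filter_upwards [h] with x hx
  rw [hx]

lemma norm_ofReal_add_le_norm_add_mul_I (x : ℝ) {u : ℂ} {s : ℝ} (hu : 0 ≤ u.im) (hs : 0 ≤ s) :
    ‖(x : ℂ) + u‖ ≤ ‖(x : ℂ) + (u + s * I)‖ := by
  rw [← sq_le_sq₀ (norm_nonneg _) (norm_nonneg _), Complex.sq_norm, Complex.sq_norm,
    Complex.normSq_apply, Complex.normSq_apply]
  simp
  nlinarith

/-- The functional `u ↦ ∫ f x / (x + u)` is determined at a single point by its values nearby in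
the imaginary direction. -/
lemma integral_div_ofReal_add_eq_zero_of_ne {f : ℝ → ℂ} {w : ℂ} (hw : 0 < w.im)
    (hf : ∀ u : ℂ, 0 < u.im → Integrable (fun x : ℝ => f x / ((x : ℂ) + u)) volume)
    (h : ∀ u : ℂ, 0 < u.im → u ≠ w → ∫ x : ℝ, f x / ((x : ℂ) + u) = 0) :
    ∫ x : ℝ, f x / ((x : ℂ) + w) = 0 := by
  have hpos : ∀ n : ℕ, (0 : ℝ) < 1 / ((n : ℝ) + 1) := fun n => Nat.one_div_pos_of_nat
  have him : ∀ n : ℕ, 0 < (w + ((1 / ((n : ℝ) + 1) : ℝ) : ℂ) * I).im := fun n => by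
    rw [Complex.add_im, Complex.im_ofReal_mul, Complex.I_im, mul_one]
    linarith [hpos n]
  have hlim : Tendsto (fun n : ℕ => ∫ x : ℝ, f x / ((x : ℂ) +
      (w + ((1 / ((n : ℝ) + 1) : ℝ) : ℂ) * I))) atTop (𝓝 (∫ x : ℝ, f x / ((x : ℂ) + w))) := by
    refine tendsto_integral_of_dominated_convergence (fun x => ‖f x / ((x : ℂ) + w)‖)
      (fun n => (hf _ (him n)).aestronglyMeasurable) (hf w hw).norm (fun n => ?_) ?_
    · refine Eventually.of_forall fun x => ?_
      rw [norm_div, norm_div]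
      exact div_le_div_of_nonneg_left (norm_nonneg _)
        (norm_pos_iff.2 (ofReal_add_ne_zero x hw))
        (norm_ofReal_add_le_norm_add_mul_I x hw.le (hpos n).le)
    · refine Eventually.of_forall fun x => ?_
      have h0 : Tendsto (fun n : ℕ => ((1 / ((n : ℝ) + 1) : ℝ) : ℂ)) atTop (𝓝 ((0 : ℝ) : ℂ)) :=
        (Complex.continuous_ofReal.tendsto 0).comp tendsto_one_div_add_atTop_nhds_zero_nat
      have h1 : Tendsto (fun n : ℕ => (x : ℂ) + (w + ((1 / ((n : ℝ) + 1) : ℝ) : ℂ) * I)) atTop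
          (𝓝 ((x : ℂ) + (w + ((0 : ℝ) : ℂ) * I))) :=
        tendsto_const_nhds.add (tendsto_const_nhds.add (h0.mul_const I))
      have h2 := (tendsto_const_nhds (x := f x)).div h1
        (by simpa using ofReal_add_ne_zero x hw)
      simp only [Complex.ofReal_zero, zero_mul, add_zero] at h2
      exact h2
  refine tendsto_nhds_unique hlim (tendsto_const_nhds.congr fun n => (h _ (him n) ?_).symm)
  intro hn
  have := congrArg Complex.im hn
  have h2 := hpos n
  rw [Complex.add_im, Complex.im_ofReal_mul, Complex.I_im, mul_one] at this
  linarith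

lemma IsHardyFun.div_ofReal_add {p : ℝ≥0∞} (hp : 1 < p) (hp' : p ≠ ⊤) {f : ℝ → ℂ}
    (hm : MemLp f p volume) (hf : IsHardyFun f) {w : ℂ} (hw : 0 < w.im) :
    MemLp (fun x : ℝ => f x / ((x : ℂ) + w)) p volume ∧
      IsHardyFun (fun x : ℝ => f x / ((x : ℂ) + w)) := by
  have hm' : MemLp (fun x : ℝ => f x / ((x : ℂ) + w)) p volume := by
    refine hm.of_le_mul (c := w.im⁻¹)
      (hm.aestronglyMeasurable.div₀
        (Measurable.aestronglyMeasurable (f := fun x : ℝ => (x : ℂ) + w) (by fun_prop)))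
      (Eventually.of_forall fun x => ?_)
    rw [norm_div, div_eq_inv_mul]
    gcongr
    exact im_le_norm_ofReal_add x w
  refine ⟨hm', ?_⟩
  have hne : ∀ u : ℂ, 0 < u.im → u ≠ w →
      ∫ x : ℝ, f x / ((x : ℂ) + w) / ((x : ℂ) + u) = 0 := by
    intro u hu huw
    have hsub : u - w ≠ 0 := sub_ne_zero.2 huw
    have : ∀ x : ℝ, f x / ((x : ℂ) + w) / ((x : ℂ) + u) =
        (u - w)⁻¹ * (f x / ((x : ℂ) + w) - f x / ((x : ℂ) + u)) := fun x => by
      have h1 := ofReal_add_ne_zero x hw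
      have h2 := ofReal_add_ne_zero x hu
      field_simp
      ring
    simp_rw [this]
    rw [integral_const_mul, integral_sub (integrable_div_ofReal_add hp hp' hm hw)
      (integrable_div_ofReal_add hp hp' hm hu), hf w hw, hf u hu]
    simp
  intro u hu
  by_cases huw : u = w
  · subst huw
    exact integral_div_ofReal_add_eq_zero_of_ne hw
      (fun u hu => integrable_div_ofReal_add hp hp' hm' hu) hne
  · exact hne u hu huw

lemma IsHardyFun.div_ofReal_add_pow {p : ℝ≥0∞} (hp : 1 < p) (hp' : p ≠ ⊤) {f : ℝ → ℂ}
    (hm : MemLp f p volume) (hf : IsHardyFun f) {w : ℂ} (hw : 0 < w.im) (n : ℕ) :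
    MemLp (fun x : ℝ => f x / ((x : ℂ) + w) ^ n) p volume ∧
      IsHardyFun (fun x : ℝ => f x / ((x : ℂ) + w) ^ n) := by
  induction n with
  | zero => simpa using ⟨hm, hf⟩
  | succ n ih =>
    have := IsHardyFun.div_ofReal_add hp hp' ih.1 ih.2 hw
    simpa only [pow_succ, div_div] using this

lemma isHardyFun_inv_ofReal_add {w : ℂ} (hw : 0 < w.im) :
    IsHardyFun (fun x : ℝ => ((x : ℂ) + w)⁻¹) := by
  have h2 : MemLp (fun x : ℝ => ((x : ℂ) + w)⁻¹) 2 volume :=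
    memLp_inv_ofReal_add (by norm_num) (by norm_num) hw
  have hinteg : ∀ u : ℂ, 0 < u.im →
      Integrable (fun x : ℝ => ((x : ℂ) + w)⁻¹ / ((x : ℂ) + u)) volume :=
    fun u hu => integrable_div_ofReal_add (by norm_num) (by norm_num) h2 hu
  have hne : ∀ u : ℂ, 0 < u.im → u ≠ w →
      ∫ x : ℝ, ((x : ℂ) + w)⁻¹ / ((x : ℂ) + u) = 0 := by
    intro u hu huw
    have hsub : u - w ≠ 0 := sub_ne_zero.2 huw
    have hslit : ∀ x : ℝ, ((x : ℂ) + w) / ((x : ℂ) + u) ∈ slitPlane := by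
      intro x
      have hu0 := ofReal_add_ne_zero x hu
      rw [Complex.mem_slitPlane_iff_not_le_zero]
      intro hle
      obtain ⟨h1, h2⟩ := Complex.le_def.1 hle
      set r := ((x : ℂ) + w) / ((x : ℂ) + u) with hr
      have hrr : r = (r.re : ℂ) := Complex.ext (by simp) (by simpa using h2)
      have : (x : ℂ) + w = (r.re : ℂ) * ((x : ℂ) + u) := by
        rw [← hrr, hr, div_mul_cancel₀ _ hu0]
      have him := congrArg Complex.im this
      rw [Complex.im_ofReal_mul] at him
      simp only [Complex.add_im, Complex.ofReal_im, zero_add] at him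
      simp only [Complex.zero_re] at h1
      nlinarith
    have hderiv : ∀ x : ℝ, HasDerivAt
        (fun x : ℝ => (u - w)⁻¹ * Complex.log (((x : ℂ) + w) / ((x : ℂ) + u)))
        (((x : ℂ) + w)⁻¹ / ((x : ℂ) + u)) x := by
      intro x
      have hw0 := ofReal_add_ne_zero x hw
      have hu0 := ofReal_add_ne_zero x hu
      have hx : HasDerivAt (fun y : ℝ => (y : ℂ)) 1 x := Complex.ofRealCLM.hasDerivAt
      have := (((hx.add_const w).div (hx.add_const u) hu0).clog_real (hslit x)).const_mul
        (u - w)⁻¹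
      convert! this using 1
      simp only [Pi.div_apply]
      field_simp
      ring
    have hlim : ∀ l : Filter ℝ, l ≤ cocompact ℝ → Tendsto
        (fun x : ℝ => (u - w)⁻¹ * Complex.log (((x : ℂ) + w) / ((x : ℂ) + u))) l (𝓝 0) := by
      intro l hl
      have hinf : Tendsto (fun x : ℝ => ((x : ℂ) + u)⁻¹) l (𝓝 0) := by
        refine tendsto_inv₀_cobounded.comp ?_
        refine tendsto_norm_atTop_iff_cobounded.1 ?_
        refine tendsto_atTop_mono (f := fun x : ℝ => ‖x‖ - ‖u‖) (fun x => ?_)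
          (tendsto_atTop_add_const_right _ _ ((tendsto_norm_cocompact_atTop).mono_left hl))
        have := norm_sub_le ((x : ℂ) + u) u
        simp only [add_sub_cancel_right, Complex.norm_real] at this
        linarith
      have h1 : Tendsto (fun x : ℝ => ((x : ℂ) + w) / ((x : ℂ) + u)) l (𝓝 1) := by
        have : Tendsto (fun x : ℝ => 1 + (w - u) * ((x : ℂ) + u)⁻¹) l (𝓝 (1 + (w - u) * 0)) :=
          (hinf.const_mul _).const_add _
        simp only [mul_zero, add_zero] at this
        refine this.congr fun x => ?_
        have hu0 := ofReal_add_ne_zero x hu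
        field_simp
        ring
      have h3 := ((continuousAt_clog one_mem_slitPlane).tendsto.comp h1).const_mul (u - w)⁻¹
      simpa using h3
    have := integral_of_hasDerivAt_of_tendsto hderiv (hinteg u hu)
      (hlim _ atBot_le_cocompact) (hlim _ atTop_le_cocompact)
    simpa using this
  intro u hu
  by_cases huw : u = w
  · subst huw
    exact integral_div_ofReal_add_eq_zero_of_ne hw hinteg hne
  · exact hne u hu huw

lemma norm_cexp_I_mul_ofReal (l x : ℝ) : ‖cexp (I * l * x)‖ = 1 := by
  rw [show I * (l : ℂ) * x = ((l * x : ℝ) : ℂ) * I by push_cast; ring,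
    Complex.norm_exp_ofReal_mul_I]

lemma memLp_cexp_mul {p : ℝ≥0∞} {f : ℝ → ℂ} (hf : MemLp f p volume) (l : ℝ) :
    MemLp (fun x : ℝ => cexp (I * l * x) * f x) p volume :=
  hf.of_le_mul (c := 1) ((Measurable.aestronglyMeasurable
    (f := fun x : ℝ => cexp (I * l * x)) (by fun_prop)).mul hf.aestronglyMeasurable)
    (Eventually.of_forall fun x => by rw [norm_mul, norm_cexp_I_mul_ofReal])

lemma IsHardyFun.cexp_mul {p : ℝ≥0∞} (hp : 1 < p) (hp' : p ≠ ⊤) {f : ℝ → ℂ}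
    (hm : MemLp f p volume) (hf : IsHardyFun f) {s : ℝ} (hs : 0 ≤ s) :
    IsHardyFun (fun x : ℝ => cexp (I * s * x) * f x) := by
  rcases hs.eq_or_lt with rfl | hs
  · simpa using hf
  have hre : ∀ (x : ℝ) (n : ℕ), 1 ≤ ‖1 + -(I * s * x) / (n : ℂ)‖ := by
    intro x n
    have : -(I * (s : ℂ) * x) / (n : ℂ) = ((-(s * x) / n : ℝ) : ℂ) * I := by
      push_cast; ring
    have h := Complex.abs_re_le_norm (1 + -(I * (s : ℂ) * x) / (n : ℂ))
    rw [this] at h ⊢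
    rw [Complex.add_re, Complex.re_ofReal_mul, Complex.I_re] at h
    simpa using h
  intro u hu
  have hz : ∀ n : ℕ, 0 < n → ∫ x : ℝ, ((1 + -(I * s * x) / (n : ℂ)) ^ n)⁻¹ *
      (f x / ((x : ℂ) + u)) = 0 := by
    intro n hn
    have hn' : (0 : ℝ) < n := Nat.cast_pos.2 hn
    have hw : 0 < (((n / s : ℝ) : ℂ) * I).im := by
      rw [Complex.im_ofReal_mul, Complex.I_im, mul_one]; positivity
    have hH := (IsHardyFun.div_ofReal_add_pow hp hp' hm hf hw n).2 u hu
    have : ∀ x : ℝ, ((1 + -(I * s * x) / (n : ℂ)) ^ n)⁻¹ * (f x / ((x : ℂ) + u)) =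
        ((-(I * s) / (n : ℂ)) ^ n)⁻¹ *
          (f x / ((x : ℂ) + ((n / s : ℝ) : ℂ) * I) ^ n / ((x : ℂ) + u)) := by
      intro x
      have hsC : (s : ℂ) ≠ 0 := by exact_mod_cast hs.ne'
      have hnC : (n : ℂ) ≠ 0 := by exact_mod_cast hn.ne'
      have hfac : 1 + -(I * s * x) / (n : ℂ) =
          (-(I * s) / (n : ℂ)) * ((x : ℂ) + ((n / s : ℝ) : ℂ) * I) := by
        push_cast
        field_simp
        ring_nf
        rw [Complex.I_sq]
        ring
      rw [hfac, mul_pow, mul_inv]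
      ring
    simp_rw [this]
    rw [integral_const_mul, hH, mul_zero]
  have hinteg := integrable_div_ofReal_add hp hp' hm hu
  have hlim : Tendsto (fun n : ℕ => ∫ x : ℝ, ((1 + -(I * s * x) / (n : ℂ)) ^ n)⁻¹ *
      (f x / ((x : ℂ) + u))) atTop
      (𝓝 (∫ x : ℝ, (cexp (-(I * s * x)))⁻¹ * (f x / ((x : ℂ) + u)))) := by
    refine tendsto_integral_of_dominated_convergence (fun x => ‖f x / ((x : ℂ) + u)‖)
      (fun n => ((Measurable.aestronglyMeasurable (by fun_prop)).mul
        hinteg.aestronglyMeasurable)) hinteg.norm (fun n => ?_) ?_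
    · refine Eventually.of_forall fun x => ?_
      rw [norm_mul, norm_inv, norm_pow]
      exact mul_le_of_le_one_left (norm_nonneg _) (inv_le_one_of_one_le₀ (one_le_pow₀ (hre x n)))
    · exact Eventually.of_forall fun x =>
        ((Complex.tendsto_one_add_div_pow_exp _).inv₀ (Complex.exp_ne_zero _)).mul_const _
  have h0 := tendsto_nhds_unique hlim (tendsto_const_nhds.congr'
    ((eventually_gt_atTop 0).mono fun n hn => (hz n hn).symm))
  rw [← h0]
  refine integral_congr_ae (Eventually.of_forall fun x => ?_)
  simp only [Complex.exp_neg, inv_inv]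
  ring

open scoped FourierTransform SchwartzMap in
lemma ae_eq_zero_of_fourier_eq_zero {G : ℝ → ℂ} (hG : Integrable G volume)
    (h : ∀ l : ℝ, ∫ x : ℝ, cexp (I * l * x) * G x = 0) : G =ᵐ[volume] 0 := by
  have hF : 𝓕 G = 0 := by
    ext ξ
    rw [Real.fourier_real_eq_integral_exp_smul]
    rw [Pi.zero_apply, ← h (-2 * Real.pi * ξ)]
    refine integral_congr_ae (Eventually.of_forall fun x => ?_)
    simp only [smul_eq_mul]
    congr 2
    push_cast
    ring
  refine ae_eq_zero_of_integral_contDiff_smul_eq_zero hG.locallyIntegrable fun g hg hgc => ?_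
  have hg₁ : HasCompactSupport (Complex.ofRealCLM ∘ g) := hgc.comp_left rfl
  have hg₂ : ContDiff ℝ ((⊤ : ℕ∞) : WithTop ℕ∞) (Complex.ofRealCLM ∘ g) := by fun_prop
  set φ : 𝓢(ℝ, ℂ) := hg₁.toSchwartzMap hg₂
  have h1 : 𝓕 ((𝓕⁻ φ : 𝓢(ℝ, ℂ)) : ℝ → ℂ) = φ := by
    rw [← SchwartzMap.fourier_coe, FourierTransform.fourier_fourierInv_eq]
  have h2 := VectorFourier.integral_fourierIntegral_smul_eq_flip (L := innerₗ ℝ) (μ := volume)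
    (ν := volume) Real.continuous_fourierChar continuous_inner
    (𝓕⁻ φ : 𝓢(ℝ, ℂ)).integrable hG
  have h3 : ∫ x : ℝ, (𝓕 ((𝓕⁻ φ : 𝓢(ℝ, ℂ)) : ℝ → ℂ)) x • G x =
      ∫ x : ℝ, ((𝓕⁻ φ : 𝓢(ℝ, ℂ)) : ℝ → ℂ) x • (𝓕 G) x := by
    simpa using! h2
  rw [h1, hF] at h3
  simpa [φ] using h3

lemma mem_mulHardy_iff {p : ℝ≥0∞} [Fact (1 ≤ p)] {l : ℝ} {g : LpR p} :
    g ∈ mulHardy p (fun x => Complex.exp (Complex.I * l * x)) ↔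
      IsHardyFun (fun x : ℝ => cexp (I * (-l : ℝ) * x) * (g : ℝ → ℂ) x) := by
  have hcancel : ∀ (x : ℝ), cexp (I * (-l : ℝ) * x) * cexp (I * l * x) = 1 := fun x => by
    rw [← Complex.exp_add]
    simp
  constructor
  · rintro ⟨f, hf, hgf⟩
    refine IsHardyFun.congr_ae (f := f) hf ?_
    filter_upwards [hgf] with x hx
    rw [hx, ← mul_assoc, hcancel, one_mul]
  · intro h
    have hm := memLp_cexp_mul (Lp.memLp g) (-l)
    refine ⟨hm.toLp _, h.congr_ae hm.coeFn_toLp.symm, ?_⟩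
    filter_upwards [hm.coeFn_toLp] with x hx
    rw [hx, ← mul_assoc, mul_comm (cexp (I * l * x)), hcancel, one_mul]

/-- `e^{iλx} H^p(ℝ)` as a subspace. -/
def mulHardySubmodule {p : ℝ≥0∞} [Fact (1 ≤ p)] (hp : 1 < p) (hp' : p ≠ ⊤) (l : ℝ) :
    Submodule ℂ (LpR p) where
  carrier := mulHardy p (fun x => Complex.exp (Complex.I * l * x))
  zero_mem' := by
    rw [mem_mulHardy_iff]
    have h0 : IsHardyFun 0 := fun u _ => by simp
    refine h0.congr_ae ?_
    filter_upwards [Lp.coeFn_zero ℂ p (volume : Measure ℝ)] with x hx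
    rw [hx, Pi.zero_apply, mul_zero]
  add_mem' := by
    intro a b ha hb
    rw [mem_mulHardy_iff] at ha hb ⊢
    refine IsHardyFun.congr_ae (f := fun x : ℝ => cexp (I * (-l : ℝ) * x) * (a : ℝ → ℂ) x +
      cexp (I * (-l : ℝ) * x) * (b : ℝ → ℂ) x) (fun u hu => ?_) ?_
    · simp_rw [add_div]
      rw [integral_add, ha u hu, hb u hu, add_zero]
      exacts [integrable_div_ofReal_add hp hp' (memLp_cexp_mul (Lp.memLp a) (-l)) hu,
        integrable_div_ofReal_add hp hp' (memLp_cexp_mul (Lp.memLp b) (-l)) hu]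
    · filter_upwards [Lp.coeFn_add a b] with x hx
      rw [hx, Pi.add_apply, mul_add]
  smul_mem' := by
    intro c a ha
    rw [mem_mulHardy_iff] at ha ⊢
    refine IsHardyFun.congr_ae (f := fun x : ℝ => c * (cexp (I * (-l : ℝ) * x) *
      (a : ℝ → ℂ) x)) (fun u hu => ?_) ?_
    · simp_rw [mul_div_assoc c]
      rw [integral_const_mul, ha u hu, mul_zero]
    · filter_upwards [Lp.coeFn_smul c a] with x hx
      rw [hx, Pi.smul_apply, smul_eq_mul, mul_left_comm]

lemma mulHardySubmodule_antitone {p : ℝ≥0∞} [Fact (1 ≤ p)] (hp : 1 < p) (hp' : p ≠ ⊤) :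
    Antitone (mulHardySubmodule hp hp') := by
  intro l m hlm g hg
  have hg' := mem_mulHardy_iff.1 (show g ∈ mulHardy p _ from hg)
  refine mem_mulHardy_iff.2 ?_
  refine (hg'.cexp_mul hp hp' (memLp_cexp_mul (Lp.memLp g) _) (sub_nonneg.2 hlm)).congr_ae
    (Eventually.of_forall fun x => ?_)
  simp only
  rw [← mul_assoc, ← Complex.exp_add]
  congr 2
  push_cast
  ring

lemma eq_zero_of_forall_mem_mulHardySubmodule {p : ℝ≥0∞} [Fact (1 ≤ p)] (hp : 1 < p)
    (hp' : p ≠ ⊤) {g : LpR p} (h : ∀ n : ℕ, g ∈ mulHardySubmodule hp hp' n) : g = 0 := by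
  have hI : 0 < I.im := by simp
  have hG := ae_eq_zero_of_fourier_eq_zero (integrable_div_ofReal_add hp hp' (Lp.memLp g) hI)
    fun l => by
      obtain ⟨n, hn⟩ := exists_nat_ge (-l)
      have hmem := mulHardySubmodule_antitone hp hp' hn (h n)
      have := (mem_mulHardy_iff.1 (show g ∈ mulHardy p _ from hmem)) I hI
      rw [neg_neg] at this
      rw [← this]
      exact integral_congr_ae (Eventually.of_forall fun x => (mul_div_assoc _ _ _).symm)
  rw [Lp.eq_zero_iff_ae_eq_zero]
  filter_upwards [hG] with x hx
  exact (div_eq_zero_iff.1 hx).resolve_right (ofReal_add_ne_zero x hI)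

/-- `L^p[t,∞)` as a subspace. -/
def halfLineSubmodule (p : ℝ≥0∞) [Fact (1 ≤ p)] (t : ℝ) : Submodule ℂ (LpR p) where
  carrier := LpHalfLine p t
  zero_mem' := by
    filter_upwards [Lp.coeFn_zero ℂ p (volume : Measure ℝ)] with x hx _
    rw [hx, Pi.zero_apply]
  add_mem' := by
    intro a b ha hb
    filter_upwards [ha, hb, Lp.coeFn_add a b] with x h1 h2 hx hxt
    rw [hx, Pi.add_apply, h1 hxt, h2 hxt, add_zero]
  smul_mem' := by
    intro c a ha
    filter_upwards [ha, Lp.coeFn_smul c a] with x h1 hx hxt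
    rw [hx, Pi.smul_apply, h1 hxt, smul_zero]

lemma halfLineSubmodule_antitone (p : ℝ≥0∞) [Fact (1 ≤ p)] :
    Antitone (halfLineSubmodule p) := by
  intro s t hst g (hg : ∀ᵐ x : ℝ, x < t → (g : ℝ → ℂ) x = 0)
  exact hg.mono fun x hx hxs => hx (hxs.trans_le hst)

lemma eq_zero_of_forall_mem_halfLineSubmodule {p : ℝ≥0∞} [Fact (1 ≤ p)] {g : LpR p}
    (h : ∀ n : ℕ, g ∈ halfLineSubmodule p n) : g = 0 := by
  rw [Lp.eq_zero_iff_ae_eq_zero]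
  filter_upwards [ae_all_iff.2 h] with x hx
  obtain ⟨n, hn⟩ := exists_nat_gt x
  exact hx n hn

lemma exists_inf_eq_bot_of_antitone {V : Type*} [AddCommGroup V] [Module ℂ V]
    (R : Submodule ℂ V) [FiniteDimensional ℂ R] {K : ℕ → Submodule ℂ V} (hK : Antitone K)
    (h0 : ∀ v, (∀ n, v ∈ K n) → v = 0) : ∃ n, ∀ v ∈ R, v ∈ K n → v = 0 := by
  obtain ⟨n, hn⟩ := IsArtinian.monotone_stabilizes (R := ℂ) (M := R)
    ⟨fun n => OrderDual.toDual ((K n).comap R.subtype),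
      fun _ _ hab => Submodule.comap_mono (hK hab)⟩
  refine ⟨n, fun v hv hvn => h0 v fun m => ?_⟩
  rcases le_total n m with hnm | hmn
  · have h1 : (K n).comap R.subtype = (K m).comap R.subtype := hn m hnm
    exact (h1 ▸ (show (⟨v, hv⟩ : R) ∈ (K n).comap R.subtype from hvn) :
      (⟨v, hv⟩ : R) ∈ (K m).comap R.subtype)
  · exact hK hmn hvn

/-- `T` annihilates the class of the function `h`. -/
def Annihilates {p : ℝ≥0∞} [Fact (1 ≤ p)] (T : LpR p →L[ℂ] LpR p) (h : ℝ → ℂ) : Prop :=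
  ∃ F : LpR p, (F : ℝ → ℂ) =ᵐ[volume] h ∧ T F = 0

section Annihilates

variable {p : ℝ≥0∞} [Fact (1 ≤ p)] {T : LpR p →L[ℂ] LpR p}

lemma Annihilates.congr {h k : ℝ → ℂ} (hh : Annihilates T h) (hk : ∀ x, h x = k x) :
    Annihilates T k := by
  obtain rfl : h = k := funext hk
  exact hh

lemma Annihilates.add {h k : ℝ → ℂ} (hh : Annihilates T h) (hk : Annihilates T k) :
    Annihilates T (fun x => h x + k x) := by
  obtain ⟨F, hF, hTF⟩ := hh
  obtain ⟨G, hG, hTG⟩ := hk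
  refine ⟨F + G, ?_, by rw [map_add, hTF, hTG, add_zero]⟩
  filter_upwards [Lp.coeFn_add F G, hF, hG] with x h1 h2 h3
  rw [h1, Pi.add_apply, h2, h3]

lemma Annihilates.const_mul {h : ℝ → ℂ} (hh : Annihilates T h) (c : ℂ) :
    Annihilates T (fun x => c * h x) := by
  obtain ⟨F, hF, hTF⟩ := hh
  refine ⟨c • F, ?_, by rw [map_smul, hTF, smul_zero]⟩
  filter_upwards [Lp.coeFn_smul c F, hF] with x h1 h2
  rw [h1, Pi.smul_apply, h2, smul_eq_mul]

lemma Annihilates.of_approx (hp : 1 < p) (hp' : p ≠ ⊤) {h : ℝ → ℂ}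
    (hm : AEStronglyMeasurable h volume)
    (H : ∀ δ : ℝ, 0 < δ → ∃ k : ℝ → ℂ, Annihilates T k ∧ ∀ x, ‖h x - k x‖ * (1 + |x|) ≤ δ) :
    Annihilates T h := by
  have hmem : MemLp h p volume := by
    obtain ⟨k, ⟨F, hF, -⟩, hk⟩ := H 1 one_pos
    have hkm : MemLp k p volume := (memLp_congr_ae hF).1 (Lp.memLp F)
    have := (memLp_of_norm_mul_one_add_abs_le hp hp' (hm.sub hkm.aestronglyMeasurable)
      (Eventually.of_forall hk)).add hkm
    simpa using this
  have hw : MemLp (fun x : ℝ => (((1 + |x|)⁻¹ : ℝ) : ℂ)) p volume := by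
    refine memLp_of_norm_mul_one_add_abs_le hp hp' (Measurable.aestronglyMeasurable (by fun_prop))
      (C := 1) (Eventually.of_forall fun x => ?_)
    have hx : 0 < 1 + |x| := by positivity
    rw [Complex.norm_real, Real.norm_eq_abs, abs_of_pos (inv_pos.2 hx), inv_mul_cancel₀ hx.ne']
  refine ⟨hmem.toLp h, hmem.coeFn_toLp, ?_⟩
  have hbound : ∀ δ : ℝ, 0 < δ → ‖T (hmem.toLp h)‖ ≤ δ * (‖T‖ * ‖hw.toLp _‖) := by
    intro δ hδ
    obtain ⟨k, ⟨F, hF, hTF⟩, hk⟩ := H δ hδ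
    have h1 : ‖hmem.toLp h - F‖ ≤ δ * ‖hw.toLp _‖ := by
      refine Lp.norm_le_mul_norm_of_ae_le_mul ?_
      filter_upwards [Lp.coeFn_sub (hmem.toLp h) F, hmem.coeFn_toLp, hF, hw.coeFn_toLp]
        with x h1 h2 h3 h4
      have hx : 0 < 1 + |x| := by positivity
      rw [h1, Pi.sub_apply, h2, h3, h4, Complex.norm_real, Real.norm_eq_abs,
        abs_of_pos (inv_pos.2 hx), ← div_eq_mul_inv, le_div_iff₀ hx]
      exact hk x
    calc ‖T (hmem.toLp h)‖ = ‖T (hmem.toLp h - F)‖ := by rw [map_sub, hTF, sub_zero]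
      _ ≤ ‖T‖ * ‖hmem.toLp h - F‖ := T.le_opNorm _
      _ ≤ ‖T‖ * (δ * ‖hw.toLp _‖) := by gcongr
      _ = _ := by ring
  have hlim : Tendsto (fun δ : ℝ => δ * (‖T‖ * ‖hw.toLp _‖)) (𝓝[>] 0) (𝓝 0) := by
    have : Tendsto (fun δ : ℝ => δ * (‖T‖ * ‖hw.toLp _‖)) (𝓝 0) (𝓝 (0 * (‖T‖ * ‖hw.toLp _‖))) :=
      tendsto_id.mul_const _
    rw [zero_mul] at this
    exact this.mono_left nhdsWithin_le_nhds
  exact norm_le_zero_iff.1 (ge_of_tendsto hlim (eventually_mem_nhdsWithin.mono hbound))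

lemma Annihilates.of_vanishing {t : ℝ} (hT : ∀ f ∈ LpHalfLine p t, T f = 0) {h : ℝ → ℂ}
    (hm : MemLp h p volume) (h0 : ∀ x < t, h x = 0) : Annihilates T h := by
  refine ⟨hm.toLp h, hm.coeFn_toLp, hT _ ?_⟩
  filter_upwards [hm.coeFn_toLp] with x hx hxt
  rw [hx, h0 x hxt]

lemma Annihilates.indicator_Iio {t : ℝ} (hT : ∀ f ∈ LpHalfLine p t, T f = 0) {h : ℝ → ℂ}
    (hh : Annihilates T h) : Annihilates T ((Set.Iio t).indicator h) := by
  obtain ⟨F, hF, hTF⟩ := hh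
  have hm : MemLp h p volume := (memLp_congr_ae hF).1 (Lp.memLp F)
  have h1 : Annihilates T ((Set.Ici t).indicator h) :=
    Annihilates.of_vanishing hT (hm.indicator measurableSet_Ici)
      fun x hx => Set.indicator_of_notMem (by simpa using hx) h
  refine (Annihilates.add ⟨F, hF, hTF⟩ (h1.const_mul (-1))).congr fun x => ?_
  by_cases hx : x < t
  · simp [hx, hx.not_ge]
  · simp [hx, not_lt.1 hx]

lemma Annihilates.of_isHardyFun {l : ℝ}
    (hT : ∀ f ∈ mulHardy p (fun x => Complex.exp (Complex.I * l * x)), T f = 0) {h : ℝ → ℂ}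
    (hm : MemLp h p volume) (hh : IsHardyFun h) :
    Annihilates T (fun x => cexp (I * l * x) * h x) := by
  have hm' := memLp_cexp_mul hm l
  refine ⟨hm'.toLp _, hm'.coeFn_toLp, hT _ ⟨hm.toLp h, hh.congr_ae hm.coeFn_toLp.symm, ?_⟩⟩
  filter_upwards [hm.coeFn_toLp, hm'.coeFn_toLp] with x h1 h2
  rw [h1, h2]

lemma norm_pow_succ_sub_pow_succ_le {a b : ℂ} (ha : ‖a‖ ≤ 1) (hb : ‖b‖ ≤ 1) (n : ℕ) :
    ‖a ^ (n + 1) - b ^ (n + 1)‖ ≤ (n + 1) * ‖a - b‖ := by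
  induction n with
  | zero => simp
  | succ n ih =>
    have h : a ^ (n + 1 + 1) - b ^ (n + 1 + 1) =
        a * (a ^ (n + 1) - b ^ (n + 1)) + (a - b) * b ^ (n + 1) := by ring
    rw [h]
    have h1 : ‖a * (a ^ (n + 1) - b ^ (n + 1))‖ ≤ 1 * ((n + 1) * ‖a - b‖) := by
      rw [norm_mul]; gcongr
    have h2 : ‖(a - b) * b ^ (n + 1)‖ ≤ ‖a - b‖ * 1 := by
      rw [norm_mul, norm_pow]
      gcongr
      exact pow_le_one₀ (norm_nonneg _) hb
    calc _ ≤ _ := norm_add_le _ _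
      _ ≤ 1 * ((n + 1) * ‖a - b‖) + ‖a - b‖ * 1 := add_le_add h1 h2
      _ = _ := by push_cast; ring

lemma one_le_norm_ofReal_sub {x t : ℝ} (hx : x < t) :
    1 ≤ ‖(x : ℂ) + ((-(t + 1) : ℝ) : ℂ)‖ := by
  rw [← Complex.ofReal_add, Complex.norm_real, Real.norm_eq_abs, le_abs]
  right
  linarith

/-- Passing to the boundary pole `t + 1`, which is off the half-line `(-∞, t)`. -/
lemma Annihilates.indicator_Iio_inv_pow (hp : 1 < p) (hp' : p ≠ ⊤) {t l : ℝ}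
    (ht : ∀ f ∈ LpHalfLine p t, T f = 0)
    (hl : ∀ f ∈ mulHardy p (fun x => Complex.exp (Complex.I * l * x)), T f = 0) (n : ℕ) :
    Annihilates T ((Set.Iio t).indicator fun x : ℝ =>
      cexp (I * l * x) * ((x : ℂ) + ((-(t + 1) : ℝ) : ℂ))⁻¹ ^ (n + 1)) := by
  set v : ℂ := ((-(t + 1) : ℝ) : ℂ) with hv
  have hvim : v.im = 0 := Complex.ofReal_im _
  set C : ℝ := 1 + (1 + ‖v‖) / 1
  have hC : 0 < C := by positivity
  refine Annihilates.of_approx hp hp' ((Measurable.aestronglyMeasurable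
    (by fun_prop)).indicator measurableSet_Iio) fun δ hδ => ?_
  set ε : ℝ := δ / ((n + 1) * C) with hε
  have hεpos : 0 < ε := by positivity
  have hw : 0 < (v + ε * I).im := by
    rw [Complex.add_im, hvim, Complex.im_ofReal_mul, Complex.I_im]
    linarith
  have hH := (isHardyFun_inv_ofReal_add hw).div_ofReal_add_pow hp hp'
    (memLp_inv_ofReal_add hp hp' hw) hw n
  refine ⟨_, (Annihilates.of_isHardyFun hl hH.1 hH.2).indicator_Iio ht, fun x => ?_⟩
  by_cases hx : x < t
  · rw [Set.indicator_of_mem (Set.mem_Iio.2 hx), Set.indicator_of_mem (Set.mem_Iio.2 hx),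
      ← mul_sub, norm_mul, norm_cexp_I_mul_ofReal, one_mul]
    have h1 : 1 ≤ ‖(x : ℂ) + v‖ := one_le_norm_ofReal_sub hx
    have h2 : ‖(x : ℂ) + v‖ ≤ ‖(x : ℂ) + (v + ε * I)‖ :=
      norm_ofReal_add_le_norm_add_mul_I x hvim.ge hεpos.le
    have hn1 : (x : ℂ) + v ≠ 0 := norm_pos_iff.1 (one_pos.trans_le h1)
    have hn2 : (x : ℂ) + (v + ε * I) ≠ 0 := norm_pos_iff.1 (one_pos.trans_le (h1.trans h2))
    have hpow : ((x : ℂ) + (v + ε * I))⁻¹ / ((x : ℂ) + (v + ε * I)) ^ n =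
        ((x : ℂ) + (v + ε * I))⁻¹ ^ (n + 1) := by
      rw [pow_succ', inv_pow, div_eq_mul_inv]
    have ha : ‖((x : ℂ) + v)⁻¹‖ ≤ 1 := by rw [norm_inv]; exact inv_le_one_of_one_le₀ h1
    have hb : ‖((x : ℂ) + (v + ε * I))⁻¹‖ ≤ 1 := by
      rw [norm_inv]; exact inv_le_one_of_one_le₀ (h1.trans h2)
    have hdiff : ‖((x : ℂ) + v)⁻¹ - ((x : ℂ) + (v + ε * I))⁻¹‖ ≤ ε * ‖(x : ℂ) + v‖⁻¹ := by
      have : ((x : ℂ) + v)⁻¹ - ((x : ℂ) + (v + ε * I))⁻¹ =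
          ε * I * ((x : ℂ) + v)⁻¹ * ((x : ℂ) + (v + ε * I))⁻¹ := by
        field_simp
        ring
      rw [this, norm_mul, norm_mul, norm_mul, Complex.norm_I, Complex.norm_real,
        Real.norm_eq_abs, abs_of_pos hεpos, mul_one, norm_inv ((x : ℂ) + v)]
      exact mul_le_of_le_one_right (by positivity) hb
    have hx1 : 1 + |x| ≤ C * ‖(x : ℂ) + v‖ := one_add_abs_le_mul_norm_add one_pos h1
    have hpos : 0 < ‖(x : ℂ) + v‖ := one_pos.trans_le h1
    rw [hpow]
    calc _ ≤ ((n + 1) * (ε * ‖(x : ℂ) + v‖⁻¹)) * (C * ‖(x : ℂ) + v‖) := by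
          refine mul_le_mul ((norm_pow_succ_sub_pow_succ_le ha hb n).trans ?_) hx1
            (by positivity) (by positivity)
          gcongr
      _ = (n + 1) * C * ε := by field_simp
      _ = δ := by rw [hε]; field_simp
      _ ≤ δ := le_rfl
  · simp [hx, hδ.le]

lemma Annihilates.indicator_Iio_polynomial (hp : 1 < p) (hp' : p ≠ ⊤) {t l : ℝ}
    (ht : ∀ f ∈ LpHalfLine p t, T f = 0)
    (hl : ∀ f ∈ mulHardy p (fun x => Complex.exp (Complex.I * l * x)), T f = 0)
    (P : Polynomial ℝ) :
    Annihilates T ((Set.Iio t).indicator fun x : ℝ => cexp (I * l * x) *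
      (((x + -(t + 1))⁻¹ * P.eval (x + -(t + 1))⁻¹ : ℝ) : ℂ)) := by
  induction P using Polynomial.induction_on' with
  | add P Q hP hQ =>
    refine (hP.add hQ).congr fun x => ?_
    by_cases hx : x < t
    · simp only [Set.indicator_of_mem (Set.mem_Iio.2 hx), Polynomial.eval_add]
      push_cast
      ring
    · simp [hx]
  | monomial n a =>
    refine ((Annihilates.indicator_Iio_inv_pow hp hp' ht hl n).const_mul a).congr fun x => ?_
    by_cases hx : x < t
    · simp only [Set.indicator_of_mem (Set.mem_Iio.2 hx), Polynomial.eval_monomial]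
      push_cast
      ring
    · simp [hx]

lemma Annihilates.indicator_Iio_continuous (hp : 1 < p) (hp' : p ≠ ⊤) {t l : ℝ}
    (ht : ∀ f ∈ LpHalfLine p t, T f = 0)
    (hl : ∀ f ∈ mulHardy p (fun x => Complex.exp (Complex.I * l * x)), T f = 0)
    {h : ℝ → ℝ} (hc : Continuous h) (hs : HasCompactSupport h) (h0 : h (t + 1) = 0) :
    Annihilates T ((Set.Iio t).indicator fun x : ℝ => cexp (I * l * x) *
      (((x + -(t + 1))⁻¹ * h x : ℝ) : ℂ)) := by
  have hm := hc.measurable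
  set v : ℂ := ((-(t + 1) : ℝ) : ℂ) with hv
  set C : ℝ := 1 + (1 + ‖v‖) / 1
  have hC : 0 < C := by positivity
  refine Annihilates.of_approx hp hp' ((Measurable.aestronglyMeasurable
    (by fun_prop)).indicator measurableSet_Iio) fun δ hδ => ?_
  have hq : Continuous fun s : ℝ => h (t + 1 + s⁻¹) := by
    rw [continuous_iff_continuousAt]
    intro s
    rcases eq_or_ne s 0 with rfl | hs0
    · have hinf : Tendsto (fun s : ℝ => t + 1 + s⁻¹) (𝓝[≠] 0) (cocompact ℝ) := by
        rw [← Metric.cobounded_eq_cocompact]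
        refine tendsto_norm_atTop_iff_cobounded.1 ?_
        refine tendsto_atTop_mono (f := fun s : ℝ => ‖s⁻¹‖ - ‖t + 1‖) (fun s => ?_)
          (tendsto_atTop_add_const_right _ _
            (tendsto_norm_cobounded_atTop.comp tendsto_inv₀_nhdsNE_zero))
        have := norm_sub_le (t + 1 + s⁻¹) (t + 1)
        simp only [add_sub_cancel_left] at this
        linarith
      have hz : ∀ᶠ x in cocompact ℝ, h x = 0 := by
        filter_upwards [hs.isCompact.compl_mem_cocompact] with x hx
        exact image_eq_zero_of_notMem_tsupport hx
      rw [← continuousWithinAt_compl_self]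
      refine tendsto_const_nhds.congr' ?_
      filter_upwards [hinf.eventually hz] with s hs
      rw [hs, inv_zero, add_zero, h0]
    · exact ContinuousAt.comp hc.continuousAt ((continuousAt_inv₀ hs0).const_add _)
  obtain ⟨P, hP⟩ := exists_polynomial_near_of_continuousOn (-1) 0 _ hq.continuousOn (δ / C)
    (by positivity)
  refine ⟨_, Annihilates.indicator_Iio_polynomial hp hp' ht hl P, fun x => ?_⟩
  by_cases hx : x < t
  · rw [Set.indicator_of_mem (Set.mem_Iio.2 hx), Set.indicator_of_mem (Set.mem_Iio.2 hx),
      ← mul_sub, norm_mul, norm_cexp_I_mul_ofReal, one_mul, ← Complex.ofReal_sub, ← mul_sub,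
      Complex.norm_real, norm_mul, norm_inv]
    have h1 := one_le_norm_ofReal_sub hx
    have hx1 : 1 + |x| ≤ C * ‖(x : ℂ) + v‖ := one_add_abs_le_mul_norm_add one_pos h1
    rw [hv] at hx1
    rw [← Complex.ofReal_add, Complex.norm_real] at h1 hx1
    have hneg : x + -(t + 1) < -1 := by linarith
    have hmem : (x + -(t + 1))⁻¹ ∈ Set.Icc (-1 : ℝ) 0 := by
      refine ⟨?_, (inv_lt_zero.2 (by linarith)).le⟩
      have := (abs_le.1 (show |(x + -(t + 1))⁻¹| ≤ 1 by
        rw [abs_inv]; exact inv_le_one_of_one_le₀ h1)).1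
      exact this
    have hPx := hP _ hmem
    rw [inv_inv, add_comm (t + 1), neg_add_cancel_right, abs_sub_comm] at hPx
    have hpos : 0 < ‖x + -(t + 1)‖ := one_pos.trans_le h1
    calc _ ≤ (‖x + -(t + 1)‖⁻¹ * (δ / C)) * (C * ‖x + -(t + 1)‖) := by
          refine mul_le_mul ?_ hx1 (by positivity) (by positivity)
          gcongr
          exact hPx.le
      _ = δ := by field_simp
      _ ≤ δ := le_rfl
  · simp [hx, hδ.le]

theorem eq_zero_of_annihilates_halfLine_of_annihilates_mulHardy (hp : 1 < p) (hp' : p ≠ ⊤)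
    {t l : ℝ} (ht : ∀ f ∈ LpHalfLine p t, T f = 0)
    (hl : ∀ f ∈ mulHardy p (fun x => Complex.exp (Complex.I * l * x)), T f = 0) : T = 0 := by
  have hcc : ∀ f : ℝ → ℂ, Continuous f → HasCompactSupport f → MemLp f p volume →
      Annihilates T f := by
    intro f hf hfs hfm
    set h : ℝ → ℂ := fun x => cexp (-(I * l * x)) * ((x + -(t + 1) : ℝ) : ℂ) * f x with hh
    have hc : Continuous h := by fun_prop
    have hs : HasCompactSupport h := hfs.mul_left
    have h0 : h (t + 1) = 0 := by simp [hh]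
    have hre := Annihilates.indicator_Iio_continuous hp hp' ht hl
      (h := fun x => (h x).re) (Complex.continuous_re.comp hc)
      (hs.comp_left (g := Complex.re) rfl) (by simp [h0])
    have him := Annihilates.indicator_Iio_continuous hp hp' ht hl
      (h := fun x => (h x).im) (Complex.continuous_im.comp hc)
      (hs.comp_left (g := Complex.im) rfl) (by simp [h0])
    have hright : Annihilates T ((Set.Ici t).indicator f) :=
      Annihilates.of_vanishing ht (hfm.indicator measurableSet_Ici)
        fun x hx => Set.indicator_of_notMem (by simpa using hx) f
    refine ((hre.add (him.const_mul I)).add hright).congr fun x => ?_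
    by_cases hx : x < t
    · have hne : ((x + -(t + 1) : ℝ) : ℂ) ≠ 0 := by
        exact_mod_cast (show x + -(t + 1) < 0 by linarith).ne
      rw [Set.indicator_of_mem (Set.mem_Iio.2 hx), Set.indicator_of_mem (Set.mem_Iio.2 hx),
        Set.indicator_of_notMem (by simpa using hx), add_zero, Complex.ofReal_mul,
        Complex.ofReal_mul, Complex.ofReal_inv]
      calc _ = cexp (I * l * x) * ((x + -(t + 1) : ℝ) : ℂ)⁻¹ * ((h x).re + (h x).im * I) := by
            ring
        _ = cexp (I * l * x) * cexp (-(I * l * x)) *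
            (((x + -(t + 1) : ℝ) : ℂ)⁻¹ * ((x + -(t + 1) : ℝ) : ℂ)) * f x := by
            rw [Complex.re_add_im, hh]; ring
        _ = f x := by
            rw [← Complex.exp_add, add_neg_cancel, Complex.exp_zero, inv_mul_cancel₀ hne]; ring
    · simp [hx, not_lt.1 hx]
  ext1 g
  have hbound : ∀ ε : ℝ, 0 < ε → ‖T g‖ ≤ ε * ‖T‖ := by
    intro ε hε
    obtain ⟨f, hfs, hgf, hfc, hfm⟩ := (Lp.memLp g).exists_hasCompactSupport_eLpNorm_sub_le hp'
      (ε := ENNReal.ofReal ε) (by simpa using hε)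
    obtain ⟨F, hF, hTF⟩ := hcc f hfc hfs hfm
    have h1 : ‖g - F‖ ≤ ε := by
      rw [Lp.norm_def]
      refine ENNReal.toReal_le_of_le_ofReal hε.le (le_trans (le_of_eq ?_) hgf)
      refine eLpNorm_congr_ae ?_
      filter_upwards [Lp.coeFn_sub g F, hF] with x h1 h2
      rw [h1, Pi.sub_apply, Pi.sub_apply, h2]
    calc ‖T g‖ = ‖T (g - F)‖ := by rw [map_sub, hTF, sub_zero]
      _ ≤ ‖T‖ * ‖g - F‖ := T.le_opNorm _
      _ ≤ ‖T‖ * ε := by gcongr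
      _ = _ := mul_comm _ _
  have hlim : Tendsto (fun ε : ℝ => ε * ‖T‖) (𝓝[>] 0) (𝓝 0) := by
    have : Tendsto (fun ε : ℝ => ε * ‖T‖) (𝓝 0) (𝓝 (0 * ‖T‖)) := tendsto_id.mul_const _
    rw [zero_mul] at this
    exact this.mono_left nhdsWithin_le_nhds
  exact norm_le_zero_iff.1 (ge_of_tendsto hlim (eventually_mem_nhdsWithin.mono hbound))

end Annihilates

/-- The Fourier binest algebra contains no nonzero finite-rank
operator. -/
theorem fourierBinest_no_finite_rank
    (p : ℝ≥0∞) [Fact (1 ≤ p)] (hp : 1 < p) (hp' : p ≠ ⊤)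
    (T : LpR p →L[ℂ] LpR p) (hT : T ∈ fourierBinest p)
    (hfr : FiniteDimensional ℂ (LinearMap.range (T : LpR p →ₗ[ℂ] LpR p))) :
    T = 0 := by
  obtain ⟨m, hm⟩ := exists_inf_eq_bot_of_antitone (LinearMap.range (T : LpR p →ₗ[ℂ] LpR p))
    (K := fun n : ℕ => halfLineSubmodule p n)
    (fun a b hab => halfLineSubmodule_antitone p (by exact_mod_cast hab))
    fun _ => eq_zero_of_forall_mem_halfLineSubmodule
  obtain ⟨n, hn⟩ := exists_inf_eq_bot_of_antitone (LinearMap.range (T : LpR p →ₗ[ℂ] LpR p))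
    (K := fun n : ℕ => mulHardySubmodule hp hp' n)
    (fun a b hab => mulHardySubmodule_antitone hp hp' (by exact_mod_cast hab))
    fun _ => eq_zero_of_forall_mem_mulHardySubmodule hp hp'
  exact eq_zero_of_annihilates_halfLine_of_annihilates_mulHardy hp hp' (t := m) (l := n)
    (fun f hf => hm _ (LinearMap.mem_range_self _ f) (hT.1 m f hf))
    fun f hf => hn _ (LinearMap.mem_range_self _ f) (hT.2 n f hf)

end
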